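/- Let K be a field and a, b, c pairwise coprime positive integers. Suppose f is a negative curve, i.e., f is an irreducible homogeneous element of [𝔭_K(a,b,c)^{(r0)}]_{d0} with d0/r0 < √(abc). If g ∈ [𝔭_K(a,b,c)^{(r)}]_d for positive integers r, d with d/r < abc/(d0/r0) (i.e., d·d0 < abc·r·r0), then f divides g. In particular, a negative curve, if it exists, is unique up to multiplication by an element of K^×. -/

import Mathlib

open MvPolynomial

noncomputable section

/-- The weight function assigning degrees `a, b, c` to the variables `x, y, z`. -/
def wt (a b c : ℕ) : Fin 3 → ℕ := ![a, b, c]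

/-- The `K`-algebra map `K[x,y,z] → K[T]`, `x ↦ T^a`, `y ↦ T^b`, `z ↦ T^c`. -/
def toPoly (K : Type*) [CommRing K] (a b c : ℕ) :
    MvPolynomial (Fin 3) K →ₐ[K] Polynomial K :=
  aeval ![Polynomial.X ^ a, Polynomial.X ^ b, Polynomial.X ^ c]

/-- The space monomial prime `𝔭_K(a,b,c)`. -/
def pIdeal (K : Type*) [CommRing K] (a b c : ℕ) : Ideal (MvPolynomial (Fin 3) K) :=
  RingHom.ker (toPoly K a b c)

instance pIdeal_isPrime (K : Type*) [Field K] (a b c : ℕ) : (pIdeal K a b c).IsPrime :=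
  RingHom.ker_isPrime _

/-- The `n`-th symbolic power `Q^{(n)} = Q^n A_Q ∩ A` of a prime ideal. -/
def symbPow {A : Type*} [CommRing A] (Q : Ideal A) [Q.IsPrime] (n : ℕ) : Ideal A :=
  Ideal.comap (algebraMap A (Localization.AtPrime Q))
    (Ideal.map (algebraMap A (Localization.AtPrime Q)) (Q ^ n))

/-- The symbolic Rees algebra `A[Qt, Q^{(2)}t^2, …] ⊆ A[t]`. -/
def symbolicRees {A : Type*} [CommRing A] (Q : Ideal A) [Q.IsPrime] :
    Subalgebra A (Polynomial A) :=
  Algebra.adjoin A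
    (⋃ n : ℕ, (fun p => Polynomial.C p * Polynomial.X ^ n) '' ((symbPow Q n : Ideal A) : Set A))

/-- The degree-`d` homogeneous component `[J]_d` of an ideal `J ⊆ K[x,y,z]`,
as a `K`-subspace. -/
def gpiece (K : Type*) [CommRing K] (a b c : ℕ) (J : Ideal (MvPolynomial (Fin 3) K))
    (d : ℕ) : Submodule K (MvPolynomial (Fin 3) K) :=
  (Submodule.restrictScalars K J) ⊓ (weightedHomogeneousSubmodule K (wt a b c) d)

end

theorem exists_mul_eq_mul_add_one {a b : ℕ} (ha : 0 < a) (hb : 0 < b) (hab : Nat.Coprime a b) :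
    ∃ q p : ℕ, b * q = a * p + 1 := by
  obtain ⟨x, hx1, hx0⟩ := Nat.chineseRemainder hab 1 0
  obtain ⟨q, hq⟩ := (Nat.modEq_zero_iff_dvd.mp hx0)
  have hpos : 1 ≤ x + a * b := Nat.le_add_left_of_le (Nat.mul_pos ha hb)
  have h : 1 ≡ x + a * b [MOD a] := by
    simpa [Nat.ModEq] using hx1.symm
  obtain ⟨p, hp⟩ := (Nat.modEq_iff_dvd' hpos).mp h
  refine ⟨q + a, p, ?_⟩
  rw [← hp, mul_add, ← hq, mul_comm b a]
  omega

/-- In every sufficiently large degree `n` the monomials `x ^ i * y ^ j * z ^ l` realize a full box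
of exponents `(q * i + p * j, l)`. -/
theorem exists_exponent_box {a b c q p : ℕ} (hb : 0 < b)
    (hqp : b * q = a * p + 1) (k n : ℕ) (hn : a * b * (k + 1) + b * q * c * k ≤ n) :
    ∃ E : ℕ, ∀ m l : ℕ, m < k → l < k →
      ∃ i j : ℕ, a * i + b * j + c * l = n ∧ q * i + p * j = E + m := by
  refine ⟨p * n / b + 1, fun m l hm hl => ?_⟩
  set E := p * n / b + 1 with hE
  have hE1 : p * n ≤ b * E := by
    have := Nat.lt_mul_div_succ (p * n) hb
    exact this.le
  have hE2 : b * E ≤ p * n + b := by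
    rw [hE, mul_add, mul_one]
    exact Nat.add_le_add_right (Nat.mul_div_le _ _) _
  have hcl : c * l ≤ c * k := Nat.mul_le_mul_left _ hl.le
  have hbq : 1 ≤ b * q := by omega
  have hcn : c * k ≤ n := by
    have := Nat.mul_le_mul_right (c * k) hbq
    have := Nat.zero_le (a * b * (k + 1))
    linarith
  obtain ⟨D, hD⟩ := Nat.exists_eq_add_of_le (hcl.trans hcn)
  have h1 : p * D ≤ b * (E + m) := by
    have : p * D ≤ p * n := Nat.mul_le_mul_left _ (by omega)
    nlinarith
  have h2 : a * (E + m) ≤ q * D := by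
    refine Nat.le_of_mul_le_mul_left ?_ hb
    have e1 : a * (b * E) ≤ a * (p * n + b) := Nat.mul_le_mul_left _ hE2
    have e2 : a * b * m ≤ a * b * k := Nat.mul_le_mul_left _ hm.le
    have e3 : b * q * (c * l) ≤ b * q * (c * k) := Nat.mul_le_mul_left _ hcl
    have e4 : b * q * n = a * p * n + n := by rw [hqp]; ring
    have e5 : b * q * n = b * q * (c * l) + b * q * D := by rw [hD]; ring
    nlinarith
  obtain ⟨i, hi⟩ := Nat.exists_eq_add_of_le h1
  obtain ⟨j, hj⟩ := Nat.exists_eq_add_of_le h2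
  refine ⟨i, j, ?_, ?_⟩
  · zify at *
    linear_combination (-a) * hi - b * hj + D * hqp - hD
  · zify at *
    linear_combination (-q) * hi - p * hj + (E + m) * hqp

/-- A sequence whose second difference is at least `R` and which is bounded by
`(l * D + M) ^ 2 / P` satisfies `P * R ≤ 2 * D ^ 2`. -/
theorem mul_le_of_second_difference_le {P R D M : ℤ} (hD : 0 ≤ D) (hM : 0 ≤ M)
    (hP : 0 ≤ P) (v : ℕ → ℤ) (hv0 : ∀ l, 0 ≤ v l)
    (hv : ∀ l, 2 * v (l + 1) + R ≤ v (l + 2) + v l)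
    (hub : ∀ l : ℕ, P * v l ≤ (l * D + M) ^ 2) : P * R ≤ 2 * D ^ 2 := by
  have hstep : ∀ l : ℕ, R * l - v 0 ≤ v (l + 1) - v l := by
    intro l
    induction l with
    | zero => simpa using hv0 1
    | succ l ih => push_cast; linarith [hv l]
  have hlow : ∀ l : ℕ, R * l * (l - 1) - 2 * v 0 * l ≤ 2 * v l := by
    intro l
    induction l with
    | zero => simpa using hv0 0
    | succ l ih => push_cast; linarith [hstep l]
  by_contra! hcon
  set A := P * R - 2 * D ^ 2 with hA
  have hA1 : 1 ≤ A := by omega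
  set B := P * R + 2 * P * v 0 + 4 * D * M with hB
  have hineq : ∀ l : ℕ, A * l ^ 2 ≤ B * l + 2 * M ^ 2 := by
    intro l
    have h1 := mul_le_mul_of_nonneg_left (hlow l) hP
    have h2 := hub l
    rw [hA, hB]
    linarith
  have hBpos : 0 ≤ B := by
    have := mul_nonneg hP (hv0 0)
    have := mul_nonneg hD hM
    nlinarith [sq_nonneg D]
  obtain ⟨L, hL⟩ := Int.eq_ofNat_of_zero_le (show 0 ≤ B + 2 * M ^ 2 + 1 by positivity)
  have h := hineq L
  have hL1 : (1 : ℤ) ≤ L := by rw [← hL]; nlinarith [sq_nonneg M]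
  have h3 : (L : ℤ) * L ≤ A * L ^ 2 := by nlinarith [sq_nonneg (L : ℤ)]
  have h4 : (L : ℤ) * L = B * L + 2 * M ^ 2 * L + L := by rw [← hL]; ring
  nlinarith [sq_nonneg M]

theorem sum_two_mul_sub_le (A C n : ℤ) (L : ℕ) :
    ∑ l ∈ Finset.range L, 2 * C * (n - C * l + A) ≤ (n + (A + C)) ^ 2 := by
  suffices h : ∑ l ∈ Finset.range L, 2 * C * (n - C * l + A) + (n - C * L + (A + C)) ^ 2 ≤
      (n + (A + C)) ^ 2 by
    nlinarith [sq_nonneg (n - C * L + (A + C))]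
  induction L with
  | zero => simp
  | succ L ih =>
    rw [Finset.sum_range_succ]
    push_cast
    nlinarith [sq_nonneg C]

theorem weight_wt (a b c : ℕ) (e : Fin 3 →₀ ℕ) :
    Finsupp.weight (wt a b c) e = a * e 0 + b * e 1 + c * e 2 := by
  rw [Finsupp.weight_apply, Finsupp.sum_fintype _ _ (by simp), Fin.sum_univ_three]
  simp [wt, mul_comm]

theorem weightedHomogeneousSubmodule_eq_restrictSupport (K : Type*) [Field K] (a b c n : ℕ) :
    weightedHomogeneousSubmodule K (wt a b c) n =
      restrictSupport K {e | Finsupp.weight (wt a b c) e = n} := by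
  ext p
  simp [mem_weightedHomogeneousSubmodule, IsWeightedHomogeneous, mem_restrictSupport_iff,
    Set.subset_def]

theorem finite_weightedHomogeneousSubmodule (K : Type*) [Field K] {a b c : ℕ}
    (ha : 0 < a) (hb : 0 < b) (hc : 0 < c) (n : ℕ) :
    Module.Finite K (weightedHomogeneousSubmodule K (wt a b c) n) := by
  refine Module.Finite.iff_fg.mpr (weightedHomogeneousSubmodule_fg _ _ (fun i => ?_) n)
  fin_cases i <;> simp [wt] <;> omega

/-- Quasi-polynomial upper bound for the Hilbert function of the weighted polynomial ring. -/
theorem finrank_weightedHomogeneousSubmodule_le (K : Type*) [Field K] {a b c : ℕ}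
    (ha : 0 < a) (hb : 0 < b) (hc : 0 < c) (hab : Nat.Coprime a b) (n : ℕ) :
    2 * a * b * c * Module.finrank K (weightedHomogeneousSubmodule K (wt a b c) n) ≤
      (n + (a * b + c)) ^ 2 := by
  let s : Set (Fin 3 →₀ ℕ) := {e | Finsupp.weight (wt a b c) e = n}
  let t : Finset (Σ _ : ℕ, ℕ) := (Finset.range (n / c + 1)).sigma
    fun l => Finset.range ((n - c * l) / (a * b) + 1)
  have hab0 : 0 < a * b := Nat.mul_pos ha hb
  let F : s → t := fun e => ⟨⟨e.1 2, e.1 0 / b⟩, by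
    have h : a * e.1 0 + b * e.1 1 + c * e.1 2 = n := by
      rw [← weight_wt]; exact e.2
    simp only [t, Finset.mem_sigma, Finset.mem_range, Nat.lt_succ_iff]
    refine ⟨(Nat.le_div_iff_mul_le hc).mpr (by rw [mul_comm]; omega), ?_⟩
    rw [← Nat.div_div_eq_div_mul]
    refine Nat.div_le_div_right ((Nat.le_div_iff_mul_le ha).mpr ?_)
    rw [mul_comm]
    omega⟩
  have hF : Function.Injective F := by
    rintro ⟨e, he⟩ ⟨e', he'⟩ hee
    have h : a * e 0 + b * e 1 + c * e 2 = n := by rw [← weight_wt]; exact he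
    have h' : a * e' 0 + b * e' 1 + c * e' 2 = n := by rw [← weight_wt]; exact he'
    simp only [F, Subtype.mk.injEq, Sigma.mk.injEq, heq_eq_eq] at hee
    obtain ⟨h2, h0⟩ := hee
    have hmod : e 0 ≡ e' 0 [MOD b] := by
      refine Nat.ModEq.cancel_left_of_coprime (c := a) (by simpa using hab.symm) ?_
      have : a * e 0 + b * e 1 = a * e' 0 + b * e' 1 := by rw [h2] at h; omega
      calc a * e 0 ≡ a * e 0 + b * e 1 [MOD b] := by simp [Nat.ModEq]
        _ = a * e' 0 + b * e' 1 := this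
        _ ≡ a * e' 0 [MOD b] := by simp [Nat.ModEq]
    have h0' : e 0 = e' 0 := by
      rw [← Nat.div_add_mod (e 0) b, ← Nat.div_add_mod (e' 0) b, h0, hmod]
    have h1' : e 1 = e' 1 := by
      rw [h2, h0'] at h
      exact Nat.eq_of_mul_eq_mul_left hb (by omega)
    ext i
    fin_cases i <;> simp [h0', h1', h2]
  have : Finite s := Finite.of_injective F hF
  have : Fintype s := Fintype.ofFinite s
  have hcard : Module.finrank K (weightedHomogeneousSubmodule K (wt a b c) n) ≤
      ∑ l ∈ Finset.range (n / c + 1), ((n - c * l) / (a * b) + 1) := by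
    rw [weightedHomogeneousSubmodule_eq_restrictSupport,
      Module.finrank_eq_card_basis (basisRestrictSupport K s)]
    refine (Fintype.card_le_of_injective F hF).trans ?_
    simp [t]
  refine (Nat.mul_le_mul_left _ hcard).trans ?_
  have hz := sum_two_mul_sub_le (a * b : ℤ) c n (n / c + 1)
  zify
  refine le_trans ?_ hz
  rw [Finset.mul_sum]
  refine Finset.sum_le_sum fun l hl => ?_
  have hln : c * l ≤ n := by
    rw [Finset.mem_range, Nat.lt_succ_iff, Nat.le_div_iff_mul_le hc] at hl
    rwa [mul_comm]
  have h1 : a * b * ((n - c * l) / (a * b)) ≤ n - c * l := Nat.mul_div_le _ _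
  zify [hln] at h1
  push_cast [hln]
  nlinarith

theorem constantCoeff_eq_zero_iff_mem_idealOfVars {σ R : Type*} [CommRing R]
    (p : MvPolynomial σ R) : constantCoeff p = 0 ↔ p ∈ idealOfVars σ R := by
  rw [← pow_one (idealOfVars σ R), mem_pow_idealOfVars_iff']
  simp [constantCoeff_eq, Finsupp.degree_eq_zero_iff]

theorem mem_pow_idealOfVars_of_mul_mem {σ F : Type*} [Field F] {h p : MvPolynomial σ F} {k : ℕ}
    (hh : constantCoeff h ≠ 0) (hp : h * p ∈ idealOfVars σ F ^ k) : p ∈ idealOfVars σ F ^ k := by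
  have hsup : Ideal.span {h} ⊔ idealOfVars σ F = ⊤ := by
    refine Ideal.eq_top_of_isUnit_mem _ (x := C (constantCoeff h)) ?_
      ((isUnit_iff_ne_zero.mpr hh).map C)
    have h1 : h - C (constantCoeff h) ∈ idealOfVars σ F := by
      rw [← constantCoeff_eq_zero_iff_mem_idealOfVars]
      simp
    rw [← sub_sub_cancel h (C (constantCoeff h))]
    exact sub_mem (Ideal.mem_sup_left (Ideal.mem_span_singleton_self h)) (Ideal.mem_sup_right h1)
  have h1 : (1 : MvPolynomial σ F) ∈ Ideal.span {h} ⊔ idealOfVars σ F ^ k := by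
    rw [Ideal.sup_pow_eq_top hsup]
    trivial
  obtain ⟨y, hy, z, hz, hyz⟩ := Submodule.mem_sup.mp h1
  obtain ⟨w, rfl⟩ := Ideal.mem_span_singleton'.mp hy
  rw [← one_mul p, ← hyz, add_mul, mul_assoc]
  exact add_mem (Ideal.mul_mem_left _ _ hp) (Ideal.mul_mem_right _ _ hz)

theorem aeval_pow_mul_of_isWeightedHomogeneous {σ R A : Type*} [CommRing R] [CommRing A]
    [Algebra R A] {w : σ → ℕ} {d : ℕ} {f : MvPolynomial σ R} (hf : f.IsWeightedHomogeneous w d)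
    (t : A) (y : σ → A) : aeval (fun i => t ^ w i * y i) f = t ^ d * aeval y f := by
  rw [aeval_def, aeval_def, eval₂_eq, eval₂_eq, Finset.mul_sum]
  refine Finset.sum_congr rfl fun e he => ?_
  have hd : ∑ i ∈ e.support, w i * e i = d := by
    rw [← hf (mem_support_iff.mp he), Finsupp.weight_apply, Finsupp.sum]
    simp [mul_comm]
  simp only [mul_pow, Finset.prod_mul_distrib, ← pow_mul, Finset.prod_pow_eq_pow_sum, hd]
  ring

/-- The coordinates, in terms of local parameters `X 0`, `X 1` at the point defined by `𝔭`, of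
the functions `x`, `y`, `z` on a slice transverse to the torus action. -/
noncomputable def sliceCoord (R : Type*) [CommRing R] (q p : ℕ) : Fin 3 → MvPolynomial (Fin 2) R :=
  ![(1 + X 0) ^ q, (1 + X 0) ^ p, 1 + X 1]

theorem aeval_mem_pow_of_mem_symbPow {K : Type*} [Field K] {a b c : ℕ} (q p : ℕ)
    {f : MvPolynomial (Fin 3) K} {r d : ℕ} (hf : f ∈ symbPow (pIdeal K a b c) r)
    (hfh : f.IsWeightedHomogeneous (wt a b c) d) :
    aeval (sliceCoord K q p) f ∈ idealOfVars (Fin 2) K ^ r := by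
  let F := FractionRing (Polynomial K)
  let T : F := algebraMap (Polynomial K) F Polynomial.X
  let ψ : MvPolynomial (Fin 3) K →ₐ[K] MvPolynomial (Fin 2) F :=
    aeval fun i => C T ^ wt a b c i * sliceCoord F q p i
  have hconst : ∀ g, constantCoeff (ψ g) = algebraMap (Polynomial K) F (toPoly K a b c g) := by
    intro g
    have : (constantCoeff.comp ψ.toRingHom) =
        (algebraMap (Polynomial K) F).comp (toPoly K a b c).toRingHom := by
      refine MvPolynomial.ringHom_ext (fun x => ?_) (fun i => ?_)
      · simp only [AlgHom.toRingHom_eq_coe, RingHom.comp_apply, RingHom.coe_coe]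
        rw [← algebraMap_eq, AlgHom.commutes, AlgHom.commutes,
          IsScalarTower.algebraMap_apply K F (MvPolynomial (Fin 2) F),
          IsScalarTower.algebraMap_apply K (Polynomial K) F]
        simp
      · fin_cases i <;> simp [ψ, toPoly, sliceCoord, wt, T]
    exact congrArg (fun φ => φ g) this
  obtain ⟨h, hh, hmem⟩ : ∃ h, h ∉ pIdeal K a b c ∧ h * f ∈ pIdeal K a b c ^ r := by
    obtain ⟨⟨⟨y, hy⟩, ⟨s, hs⟩⟩, hys⟩ := (IsLocalization.mem_map_algebraMap_iff
      (pIdeal K a b c).primeCompl (Localization.AtPrime (pIdeal K a b c))).mp hf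
    rw [← map_mul, IsLocalization.eq_iff_exists (pIdeal K a b c).primeCompl] at hys
    obtain ⟨⟨u, hu⟩, huy⟩ := hys
    refine ⟨u * s, (pIdeal K a b c).primeCompl.mul_mem hu hs, ?_⟩
    rw [mul_assoc, mul_comm s f]
    exact huy ▸ Ideal.mul_mem_left _ _ hy
  have hle : (pIdeal K a b c).map ψ ≤ idealOfVars (Fin 2) F := by
    rw [Ideal.map_le_iff_le_comap]
    intro g hg
    rw [Ideal.mem_comap, ← constantCoeff_eq_zero_iff_mem_idealOfVars, hconst,
      show toPoly K a b c g = 0 from hg, map_zero]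
  have h1 : ψ h * ψ f ∈ idealOfVars (Fin 2) F ^ r := by
    rw [← map_mul]
    refine Ideal.pow_right_mono hle r ?_
    rw [← Ideal.map_pow]
    exact Ideal.mem_map_of_mem _ hmem
  have h2 : ψ f ∈ idealOfVars (Fin 2) F ^ r := by
    refine mem_pow_idealOfVars_of_mul_mem ?_ h1
    rw [hconst]
    exact (map_ne_zero_iff _ (IsFractionRing.injective _ _)).mpr hh
  have h3 : ψ f = C (T ^ d) * map (algebraMap K F) (aeval (sliceCoord K q p) f) := by
    rw [show ψ f = _ from aeval_pow_mul_of_isWeightedHomogeneous hfh (C T) (sliceCoord F q p),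
      ← map_pow]
    congr 1
    rw [aeval_def, aeval_def, eval₂_comp_left (map (algebraMap K F))]
    congr 1
    · ext x : 1
      simp [algebraMap_eq, IsScalarTower.algebraMap_apply K F (MvPolynomial (Fin 2) F)]
    · ext i : 1
      fin_cases i <;> simp [sliceCoord]
  have hT : T ≠ 0 := (map_ne_zero_iff _ (IsFractionRing.injective _ _)).mpr Polynomial.X_ne_zero
  rw [mem_pow_idealOfVars_iff'] at h2 ⊢
  intro x hx
  have h4 := h2 x hx
  rw [h3, coeff_C_mul, coeff_map] at h4
  have h5 := (mul_eq_zero.mp h4).resolve_left (pow_ne_zero _ hT)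
  exact (map_eq_zero_iff _ (algebraMap K F).injective).mp h5

/-- The pairs `(m, l)` with `m + l < k`. -/
def pairsBelow (k : ℕ) : Finset (ℕ × ℕ) :=
  (Finset.range k).biUnion Finset.HasAntidiagonal.antidiagonal

theorem mem_pairsBelow {k : ℕ} {x : ℕ × ℕ} : x ∈ pairsBelow k ↔ x.1 + x.2 < k := by
  simp [pairsBelow]

theorem two_mul_card_pairsBelow (k : ℕ) : 2 * (pairsBelow k).card = k * (k + 1) := by
  rw [pairsBelow, Finset.card_biUnion]
  · induction k with
    | zero => simp
    | succ k ih =>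
      rw [Finset.sum_range_succ, mul_add, ih, Finset.Nat.card_antidiagonal]
      ring
  · intro i _ j _ hij
    exact Finset.disjoint_left.mpr fun x hxi hxj =>
      hij ((Finset.HasAntidiagonal.mem_antidiagonal.mp hxi).symm.trans
        (Finset.HasAntidiagonal.mem_antidiagonal.mp hxj))

/-- The exponent vector of the monomial `X 0 ^ m * X 1 ^ l`. -/
noncomputable def pairExponent (x : ℕ × ℕ) : Fin 2 →₀ ℕ :=
  Finsupp.single 0 x.1 + Finsupp.single 1 x.2

theorem pairExponent_injective : Function.Injective pairExponent := by
  intro x y h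
  have h0 := DFunLike.congr_fun h 0
  have h1 := DFunLike.congr_fun h 1
  simp [pairExponent] at h0 h1
  exact Prod.ext h0 h1

theorem mem_pow_idealOfVars_iff_pairs {R : Type*} [CommRing R] (k : ℕ)
    (P : MvPolynomial (Fin 2) R) :
    P ∈ idealOfVars (Fin 2) R ^ k ↔ ∀ x ∈ pairsBelow k, P.coeff (pairExponent x) = 0 := by
  rw [mem_pow_idealOfVars_iff']
  have hdeg : ∀ x : ℕ × ℕ, (pairExponent x).degree = x.1 + x.2 := by
    intro x
    simp [pairExponent]
  refine ⟨fun h x hx => h _ (by rw [hdeg]; exact mem_pairsBelow.mp hx), fun h e he => ?_⟩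
  have hpe : pairExponent (e 0, e 1) = e := by
    ext i
    fin_cases i <;> simp [pairExponent]
  rw [← hpe]
  refine h _ (mem_pairsBelow.mpr ?_)
  rwa [← hpe, hdeg] at he

/-- The forms of weighted degree `n` whose image under the slice map vanishes to order `k`. -/
noncomputable def vanishingForms (K : Type*) [Field K] (a b c q p n k : ℕ) :
    Submodule K (MvPolynomial (Fin 3) K) :=
  weightedHomogeneousSubmodule K (wt a b c) n ⊓
    ((idealOfVars (Fin 2) K ^ k).restrictScalars K).comap
      (aeval (sliceCoord K q p)).toLinearMap

theorem mem_vanishingForms {K : Type*} [Field K] {a b c q p n k : ℕ}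
    {f : MvPolynomial (Fin 3) K} : f ∈ vanishingForms K a b c q p n k ↔
      f.IsWeightedHomogeneous (wt a b c) n ∧
        aeval (sliceCoord K q p) f ∈ idealOfVars (Fin 2) K ^ k :=
  Iff.rfl

theorem finrank_le_finrank_vanishingForms_add (K : Type*) [Field K] {a b c : ℕ}
    (ha : 0 < a) (hb : 0 < b) (hc : 0 < c) (q p n k : ℕ) :
    Module.finrank K (weightedHomogeneousSubmodule K (wt a b c) n) ≤
      Module.finrank K (vanishingForms K a b c q p n k) + (pairsBelow k).card := by
  have := finite_weightedHomogeneousSubmodule K ha hb hc n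
  set S := weightedHomogeneousSubmodule K (wt a b c) n
  let L : MvPolynomial (Fin 3) K →ₗ[K] (pairsBelow k → K) :=
    LinearMap.pi fun x => (lcoeff K (pairExponent x)) ∘ₗ (aeval (sliceCoord K q p)).toLinearMap
  have hW : vanishingForms K a b c q p n k = S ⊓ LinearMap.ker L := by
    ext f
    simp only [vanishingForms, Submodule.mem_inf, Submodule.mem_comap,
      Submodule.restrictScalars_mem, mem_pow_idealOfVars_iff_pairs]
    simp [L, S, LinearMap.mem_ker, funext_iff]
  have hker : Module.finrank K (LinearMap.ker (L.domRestrict S)) =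
      Module.finrank K (vanishingForms K a b c q p n k) := by
    rw [LinearMap.ker_domRestrict, hW, ← Submodule.map_comap_subtype,
      ← LinearEquiv.finrank_eq (Submodule.equivMapOfInjective S.subtype S.injective_subtype _)]
  have hrn := LinearMap.finrank_range_add_finrank_ker (L.domRestrict S)
  have hr := Submodule.finrank_le (LinearMap.range (L.domRestrict S))
  rw [Module.finrank_fintype_fun_eq_card, Fintype.card_coe] at hr
  omega

theorem sum_shifted_monomials_eq_zero {K : Type*} [Field K] {k : ℕ} (E : ℕ)
    (z : pairsBelow k → K)
    (hz : (1 + X 0 : MvPolynomial (Fin 2) K) ^ E *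
      ∑ x, z x • ((1 + X 0) ^ x.1.1 * (1 + X 1) ^ x.1.2) ∈ idealOfVars (Fin 2) K ^ k) : z = 0 := by
  set Q : MvPolynomial (Fin 2) K := ∑ x, z x • ((1 + X 0) ^ x.1.1 * (1 + X 1) ^ x.1.2)
  have hQ : Q ∈ idealOfVars (Fin 2) K ^ k :=
    mem_pow_idealOfVars_of_mul_mem (by simp) hz
  have hX : ∀ i : Fin 2, (1 + X i : MvPolynomial (Fin 2) K).totalDegree ≤ 1 := fun i =>
    (totalDegree_add _ _).trans (by simp)
  have hQ0 : Q = 0 := by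
    ext e
    rw [coeff_zero]
    by_cases he : e.degree < k
    · exact (mem_pow_idealOfVars_iff' _ _).mp hQ e he
    · rw [coeff_sum]
      refine Finset.sum_eq_zero fun x _ => ?_
      rw [coeff_smul, coeff_eq_zero_of_totalDegree_lt, smul_zero]
      refine lt_of_lt_of_le ?_ (not_lt.mp he)
      refine lt_of_le_of_lt ?_ (mem_pairsBelow.mp x.2)
      refine (totalDegree_mul _ _).trans (add_le_add ?_ ?_) <;>
        refine (totalDegree_pow _ _).trans ?_
      · simpa using Nat.mul_le_mul_left x.1.1 (hX 0)
      · simpa using Nat.mul_le_mul_left x.1.2 (hX 1)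
  have h1 : ∑ x, monomial (pairExponent x.1) (z x) = 0 := by
    have h2 := congrArg (aeval (fun i : Fin 2 => (X i - 1 : MvPolynomial (Fin 2) K))) hQ0
    rw [map_zero, map_sum] at h2
    rw [← h2]
    refine Finset.sum_congr rfl fun x _ => ?_
    rw [pairExponent, ← mul_one (z x), ← smul_eq_mul, ← smul_monomial, ← one_mul (1 : K),
      ← monomial_mul]
    simp [X_pow_eq_monomial]
  funext y
  have h2 := congrArg (coeff (pairExponent y.1)) h1
  rw [coeff_sum, Finset.sum_eq_single y] at h2
  · simpa using h2
  · intro x _ hxy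
    rw [coeff_monomial, if_neg]
    exact fun h => hxy (Subtype.ext (pairExponent_injective h))
  · simp

theorem finrank_vanishingForms_add_le (K : Type*) [Field K] {a b c : ℕ}
    (ha : 0 < a) (hb : 0 < b) (hc : 0 < c) {q p n k : ℕ} (hqp : b * q = a * p + 1)
    (hn : a * b * (k + 1) + b * q * c * k ≤ n) :
    Module.finrank K (vanishingForms K a b c q p n k) + (pairsBelow k).card ≤
      Module.finrank K (weightedHomogeneousSubmodule K (wt a b c) n) := by
  have := finite_weightedHomogeneousSubmodule K ha hb hc n
  obtain ⟨E, hE⟩ := exists_exponent_box hb hqp k n hn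
  have hmon : ∀ x : pairsBelow k, ∃ e : Fin 3 →₀ ℕ, a * e 0 + b * e 1 + c * e 2 = n ∧
      q * e 0 + p * e 1 = E + x.1.1 ∧ e 2 = x.1.2 := by
    rintro ⟨⟨m, l⟩, hx⟩
    have hml := mem_pairsBelow.mp hx
    simp only at hml
    obtain ⟨i, j, hij, hij'⟩ := hE m l (by omega) (by omega)
    exact ⟨Finsupp.equivFunOnFinite.symm ![i, j, l], by simpa using hij, by simpa using hij',
      by simp⟩
  choose e he1 he2 he3 using hmon
  let θ : (pairsBelow k → K) →ₗ[K] MvPolynomial (Fin 3) K :=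
    Fintype.linearCombination K fun x => monomial (e x) (1 : K)
  have hθ : ∀ z, aeval (sliceCoord K q p) (θ z) =
      (1 + X 0) ^ E * ∑ x, z x • ((1 + X 0) ^ x.1.1 * (1 + X 1) ^ x.1.2) := by
    intro z
    simp only [θ, Fintype.linearCombination_apply, map_sum, map_smul, Finset.mul_sum]
    refine Finset.sum_congr rfl fun x _ => ?_
    rw [aeval_monomial, Finsupp.prod_fintype _ _ (by simp), Fin.prod_univ_three, mul_smul_comm,
      ← mul_assoc ((1 + X 0) ^ E), ← pow_add, ← he2, ← he3]
    simp [sliceCoord, pow_add, pow_mul]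
  have hzero : ∀ z, aeval (sliceCoord K q p) (θ z) ∈ idealOfVars (Fin 2) K ^ k → z = 0 := by
    intro z hz
    rw [hθ] at hz
    exact sum_shifted_monomials_eq_zero E z hz
  have hinj : Function.Injective θ := by
    rw [← LinearMap.ker_eq_bot, LinearMap.ker_eq_bot']
    intro z hz
    exact hzero z (by rw [hz, map_zero]; exact zero_mem _)
  have hrange : LinearMap.range θ ≤ weightedHomogeneousSubmodule K (wt a b c) n := by
    rintro _ ⟨z, rfl⟩
    simp only [θ, Fintype.linearCombination_apply]
    refine Submodule.sum_mem _ fun x _ => Submodule.smul_mem _ _ ?_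
    exact isWeightedHomogeneous_monomial _ _ _ ((weight_wt a b c _).trans (he1 x))
  have hinf : vanishingForms K a b c q p n k ⊓ LinearMap.range θ = ⊥ := by
    rw [eq_bot_iff]
    rintro _ ⟨hW, z, rfl⟩
    rw [hzero z hW.2, map_zero]
    exact zero_mem _
  have hWle : vanishingForms K a b c q p n k ≤ weightedHomogeneousSubmodule K (wt a b c) n :=
    inf_le_left
  have := Submodule.finiteDimensional_of_le hWle
  have hsum := Submodule.finrank_sup_add_finrank_inf_eq (vanishingForms K a b c q p n k)
    (LinearMap.range θ)
  rw [hinf, finrank_bot, add_zero, LinearMap.finrank_range_of_inj hinj,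
    Module.finrank_fintype_fun_eq_card, Fintype.card_coe] at hsum
  rw [← hsum]
  exact Submodule.finrank_mono (sup_le hWle hrange)

theorem isWeightedHomogeneous_of_mul {σ R : Type*} [CommRing R] [IsDomain R] {w : σ → ℕ}
    {m n : ℕ} {f g : MvPolynomial σ R} (hf0 : f ≠ 0) (hf : f.IsWeightedHomogeneous w m)
    (hfg : (f * g).IsWeightedHomogeneous w (n + m)) : g.IsWeightedHomogeneous w n := by
  classical
  have hcomp : weightedHomogeneousComponent w (n + m) (f * g) =
      f * weightedHomogeneousComponent w n g := by
    conv_lhs => rw [← sum_weightedHomogeneousComponent w g,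
      finsum_eq_sum _ (weightedHomogeneousComponent_finsupp g), Finset.mul_sum, map_sum]
    have hterm : ∀ j, weightedHomogeneousComponent w (n + m)
        (f * weightedHomogeneousComponent w j g) =
        if j = n then f * weightedHomogeneousComponent w j g else 0 := by
      intro j
      rw [weightedHomogeneousComponent_of_mem
        (hf.mul (weightedHomogeneousComponent_isWeightedHomogeneous j g))]
      refine if_congr (by omega) rfl rfl
    simp only [hterm]
    rw [Finset.sum_ite_eq']
    split_ifs with h
    · rfl
    · have h0 : weightedHomogeneousComponent w n g = 0 := by
        by_contra hne
        exact h ((Set.Finite.mem_toFinset _).mpr hne)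
      rw [h0, mul_zero]
  rw [hfg.weightedHomogeneousComponent_same] at hcomp
  rw [mul_left_cancel₀ hf0 hcomp]
  exact weightedHomogeneousComponent_isWeightedHomogeneous n g

theorem finrank_map_mulLeft {K A : Type*} [Field K] [CommRing A] [IsDomain A] [Algebra K A]
    {f : A} (hf : f ≠ 0) (W : Submodule K A) :
    Module.finrank K (W.map (LinearMap.mulLeft K f)) = Module.finrank K W :=
  (LinearEquiv.finrank_eq (Submodule.equivMapOfInjective (LinearMap.mulLeft K f)
    (fun _ _ h => mul_left_cancel₀ hf h) W)).symm

theorem finrank_vanishingForms_add_finrank_le {K : Type*} [Field K] {a b c : ℕ}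
    (ha : 0 < a) (hb : 0 < b) (hc : 0 < c) (q p : ℕ) {f g : MvPolynomial (Fin 3) K} {D r s : ℕ}
    (hf0 : f ≠ 0) (hg0 : g ≠ 0) (hfg : IsRelPrime f g)
    (hf : f ∈ vanishingForms K a b c q p D r) (hg : g ∈ vanishingForms K a b c q p D s) (n : ℕ) :
    Module.finrank K (vanishingForms K a b c q p (n + D) s) +
        Module.finrank K (vanishingForms K a b c q p (n + D) r) ≤
      Module.finrank K (vanishingForms K a b c q p (n + D + D) (r + s)) +
        Module.finrank K (weightedHomogeneousSubmodule K (wt a b c) n) := by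
  have hfin := fun m => finite_weightedHomogeneousSubmodule K ha hb hc m
  have hWfin : ∀ m k, Module.Finite K (vanishingForms K a b c q p m k) := fun m k =>
    Submodule.finiteDimensional_of_le (inf_le_left : _ ≤ weightedHomogeneousSubmodule K _ m)
  set W₁ := (vanishingForms K a b c q p (n + D) s).map (LinearMap.mulLeft K f) with hW₁
  set W₂ := (vanishingForms K a b c q p (n + D) r).map (LinearMap.mulLeft K g) with hW₂
  have hle₁ : W₁ ≤ vanishingForms K a b c q p (n + D + D) (r + s) := by
    rintro _ ⟨h, hh, rfl⟩
    refine mem_vanishingForms.mpr ⟨?_, ?_⟩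
    · simpa [add_comm] using hf.1.mul hh.1
    · rw [LinearMap.mulLeft_apply, map_mul, pow_add]
      exact Ideal.mul_mem_mul hf.2 hh.2
  have hle₂ : W₂ ≤ vanishingForms K a b c q p (n + D + D) (r + s) := by
    rintro _ ⟨h, hh, rfl⟩
    refine mem_vanishingForms.mpr ⟨?_, ?_⟩
    · simpa [add_comm] using hg.1.mul hh.1
    · rw [LinearMap.mulLeft_apply, map_mul, add_comm r s, pow_add]
      exact Ideal.mul_mem_mul hg.2 hh.2
  have hinf : W₁ ⊓ W₂ ≤
      (weightedHomogeneousSubmodule K (wt a b c) n).map (LinearMap.mulLeft K (g * f)) := by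
    rintro _ ⟨⟨A, -, rfl⟩, B, hB, hAB⟩
    simp only [LinearMap.mulLeft_apply] at hAB ⊢
    obtain ⟨C, rfl⟩ : f ∣ B := hfg.dvd_of_dvd_mul_left ⟨A, hAB⟩
    refine ⟨C, isWeightedHomogeneous_of_mul hf0 hf.1 hB.1, ?_⟩
    rw [LinearMap.mulLeft_apply, ← hAB, mul_assoc]
  have hsum := Submodule.finrank_sup_add_finrank_inf_eq W₁ W₂
  have h₁ := finrank_map_mulLeft hf0 (vanishingForms K a b c q p (n + D) s)
  have h₂ := finrank_map_mulLeft hg0 (vanishingForms K a b c q p (n + D) r)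
  have h₃ := Submodule.finrank_mono (sup_le hle₁ hle₂)
  have h₄ := Submodule.finrank_mono hinf
  rw [finrank_map_mulLeft (mul_ne_zero hg0 hf0)] at h₄
  rw [← hW₁] at h₁
  rw [← hW₂] at h₂
  omega

/-- Bézout's inequality: relatively prime forms of weighted degree `D` vanishing to order `r`
and `s` satisfy `a * b * c * (r * s) ≤ D ^ 2`. -/
theorem mul_order_le_sq_degree {K : Type*} [Field K] {a b c : ℕ}
    (ha : 0 < a) (hb : 0 < b) (hc : 0 < c) (hab : Nat.Coprime a b) {q p : ℕ}
    (hqp : b * q = a * p + 1) {f g : MvPolynomial (Fin 3) K} {D r s : ℕ}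
    (hf0 : f ≠ 0) (hg0 : g ≠ 0) (hfg : IsRelPrime f g)
    (hf : f ∈ vanishingForms K a b c q p D r) (hg : g ∈ vanishingForms K a b c q p D s) :
    a * b * c * (r * s) ≤ D ^ 2 := by
  set N := a * b * (r + s + 1) + b * q * c * (r + s) with hN
  let v : ℕ → ℤ := fun l => Module.finrank K (weightedHomogeneousSubmodule K (wt a b c) (N + l * D))
  have hv : ∀ l, 2 * v (l + 1) + (r * s : ℕ) ≤ v (l + 2) + v l := by
    intro l
    have h := finrank_vanishingForms_add_finrank_le ha hb hc q p hf0 hg0 hfg hf hg (N + l * D)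
    have e1 : N + l * D + D = N + (l + 1) * D := by ring
    have e2 : N + (l + 1) * D + D = N + (l + 2) * D := by ring
    rw [e1, e2] at h
    have hr := finrank_le_finrank_vanishingForms_add K ha hb hc q p (N + (l + 1) * D) r
    have hs := finrank_le_finrank_vanishingForms_add K ha hb hc q p (N + (l + 1) * D) s
    have hrs := finrank_vanishingForms_add_le K ha hb hc (k := r + s) (n := N + (l + 2) * D) hqp
      (Nat.le_add_right _ _)
    have tr := two_mul_card_pairsBelow r
    have ts := two_mul_card_pairsBelow s
    have trs := two_mul_card_pairsBelow (r + s)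
    have hT : (pairsBelow (r + s)).card = (pairsBelow r).card + (pairsBelow s).card + r * s := by
      linarith
    simp only [v]
    omega
  have h := mul_le_of_second_difference_le (P := (2 * a * b * c : ℕ)) (D := D)
    (M := (N + (a * b + c) : ℕ)) (by positivity) (by positivity) (by positivity) v
    (fun l => by positivity) hv (fun l => by
      have := finrank_weightedHomogeneousSubmodule_le K ha hb hc hab (N + l * D)
      zify at this
      refine this.trans_eq ?_
      push_cast
      ring)
  norm_cast at h
  linarith

/-- a negative curve `f ∈ [𝔭^{(r0)}]_{d0}` divides every
`g ∈ [𝔭^{(r)}]_d` with `d/r < abc/(d0/r0)`, i.e. `d·d0 < abc·r·r0`; in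
particular a negative curve is unique up to a unit of `K`. -/
theorem statement6 (K : Type*) [Field K] (a b c : ℕ)
    (ha : 0 < a) (hb : 0 < b) (hc : 0 < c)
    (hab : Nat.Coprime a b) (hbc : Nat.Coprime b c) (hca : Nat.Coprime c a)
    (f : MvPolynomial (Fin 3) K) (r0 d0 : ℕ) (hr0 : 0 < r0) (hd0 : 0 < d0)
    (hirr : Irreducible f)
    (hf : f ∈ symbPow (pIdeal K a b c) r0)
    (hfh : f.IsWeightedHomogeneous (wt a b c) d0)
    (hneg : d0 ^ 2 < a * b * c * r0 ^ 2) :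
    (∀ (g : MvPolynomial (Fin 3) K) (r d : ℕ), 0 < r → 0 < d →
      g ∈ symbPow (pIdeal K a b c) r →
      g.IsWeightedHomogeneous (wt a b c) d →
      d * d0 < a * b * c * (r * r0) → f ∣ g) ∧
    (∀ (f' : MvPolynomial (Fin 3) K) (r0' d0' : ℕ), 0 < r0' → 0 < d0' →
      Irreducible f' →
      f' ∈ symbPow (pIdeal K a b c) r0' →
      f'.IsWeightedHomogeneous (wt a b c) d0' →
      d0' ^ 2 < a * b * c * r0' ^ 2 →
      ∃ u : K, u ≠ 0 ∧ f' = MvPolynomial.C u * f) := by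
  have hmain : ∀ (g : MvPolynomial (Fin 3) K) (r d : ℕ), 0 < r → 0 < d →
      g ∈ symbPow (pIdeal K a b c) r →
      g.IsWeightedHomogeneous (wt a b c) d →
      d * d0 < a * b * c * (r * r0) → f ∣ g := by
    intro g r d _ hd hg hgh hlt
    by_contra hndvd
    obtain ⟨q, p, hqp⟩ := exists_mul_eq_mul_add_one ha hb hab
    have hg0 : g ≠ 0 := fun h => hndvd (h ▸ dvd_zero f)
    have hrel : IsRelPrime f g := hirr.isRelPrime_iff_not_dvd.mpr hndvd
    have hfd : f ^ d ∈ vanishingForms K a b c q p (d * d0) (r0 * d) := by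
      refine ⟨by simpa using hfh.pow d, ?_⟩
      simpa [pow_mul] using Ideal.pow_mem_pow (aeval_mem_pow_of_mem_symbPow q p hf hfh) d
    have hgd : g ^ d0 ∈ vanishingForms K a b c q p (d * d0) (r * d0) := by
      refine ⟨by simpa [mul_comm] using hgh.pow d0, ?_⟩
      simpa [pow_mul] using Ideal.pow_mem_pow (aeval_mem_pow_of_mem_symbPow q p hg hgh) d0
    have h := mul_order_le_sq_degree ha hb hc hab hqp (pow_ne_zero d hirr.ne_zero)
      (pow_ne_zero d0 hg0) hrel.pow hfd hgd
    have h1 : d * d0 * (a * b * c * (r * r0)) ≤ d * d0 * (d * d0) := by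
      calc d * d0 * (a * b * c * (r * r0)) = a * b * c * (r0 * d * (r * d0)) := by ring
        _ ≤ (d * d0) ^ 2 := h
        _ = d * d0 * (d * d0) := sq _
    exact absurd (Nat.le_of_mul_le_mul_left h1 (Nat.mul_pos hd hd0)) (not_le.mpr hlt)
  refine ⟨hmain, fun f' r0' d0' hr0' hd0' hirr' hf' hfh' hneg' => ?_⟩
  have hlt : d0' * d0 < a * b * c * (r0' * r0) := by
    refine lt_of_pow_lt_pow_left₀ 2 (Nat.zero_le _) ?_
    calc (d0' * d0) ^ 2 = d0' ^ 2 * d0 ^ 2 := mul_pow _ _ _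
      _ < (a * b * c * r0' ^ 2) * (a * b * c * r0 ^ 2) :=
        mul_lt_mul'' hneg' hneg (Nat.zero_le _) (Nat.zero_le _)
      _ = (a * b * c * (r0' * r0)) ^ 2 := by ring
  obtain ⟨u, rfl⟩ := hmain f' r0' d0' hr0' hd0' hf' hfh' hlt
  have hu := (hirr'.isUnit_or_isUnit rfl).resolve_left hirr.not_isUnit
  obtain ⟨x, hx, rfl⟩ := isUnit_iff_eq_C_of_isReduced.mp hu
  exact ⟨x, hx.ne_zero, mul_comm _ _⟩
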